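/- Let 𝒜 be a unital C*-algebra, let σ : ℝ → ℝ → ℝ be monotone in each argument on nonnegative reals, and let a ∈ 𝒜 be hyponormal, i.e., aa* ≤ a*a. Then ‖a*‖_σ ≤ ‖a‖_σ. -/

import Mathlib

/-- A state on a unital C*-algebra `A`: a continuous linear functional `f : A → ℂ`
with `f 1 = 1` and `‖f‖ = 1`. -/
def IsState {A : Type*} [CStarAlgebra A] (f : A →L[ℂ] ℂ) : Prop :=
  f 1 = 1 ∧ ‖f‖ = 1

/-- `‖a‖_σ := sup_{f ∈ S(A)} √(σ(|f(a)|², f(a*a)))`, where `f(a*a)` is the (nonnegative)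
real number `(f (star a * a)).re`. -/
noncomputable def sigmaNorm {A : Type*} [CStarAlgebra A] (σ : ℝ → ℝ → ℝ) (a : A) : ℝ :=
  sSup {x : ℝ | ∃ f : A →L[ℂ] ℂ, IsState f ∧
    x = Real.sqrt (σ (‖f a‖ ^ 2) (f (star a * a)).re)}

/-- The algebraic numerical radius `v(a) := sup_{f ∈ S(A)} |f(a)|`. -/
noncomputable def numRadius {A : Type*} [CStarAlgebra A] (a : A) : ℝ :=
  sSup {x : ℝ | ∃ f : A →L[ℂ] ℂ, IsState f ∧ x = ‖f a‖}

/-- The Crawford number `m(a) := inf_{f ∈ S(A)} |f(a)|`. -/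
noncomputable def crawford {A : Type*} [CStarAlgebra A] (a : A) : ℝ :=
  sInf {x : ℝ | ∃ f : A →L[ℂ] ℂ, IsState f ∧ x = ‖f a‖}

/-- `‖a‖_∇ := sup_{f ∈ S(A)} √((|f(a)|² + f(a*a))/2)`. -/
noncomputable def nablaNorm {A : Type*} [CStarAlgebra A] (a : A) : ℝ :=
  sSup {x : ℝ | ∃ f : A →L[ℂ] ℂ, IsState f ∧
    x = Real.sqrt ((‖f a‖ ^ 2 + (f (star a * a)).re) / 2)}

namespace IsState

variable {A : Type*} [CStarAlgebra A] {f : A →L[ℂ] ℂ}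

lemma nontrivial (hf : IsState f) : Nontrivial A := by
  refine nontrivial_of_ne (1 : A) 0 fun h => ?_
  have h1 := hf.1
  rw [h, map_zero] at h1
  exact zero_ne_one h1

lemma norm_apply_le (hf : IsState f) (a : A) : ‖f a‖ ≤ ‖a‖ := by
  simpa [hf.2] using f.le_opNorm a

lemma apply_algebraMap (hf : IsState f) (z : ℂ) : f (algebraMap ℂ A z) = z := by
  rw [Algebra.algebraMap_eq_smul_one, map_smul, hf.1, smul_eq_mul, mul_one]

lemma im_apply_eq_zero (hf : IsState f) {b : A} (hb : IsSelfAdjoint b) : (f b).im = 0 := by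
  have := hf.nontrivial
  have key (t : ℝ) : ((f b).im + t) ^ 2 ≤ ‖b‖ ^ 2 + t ^ 2 := by
    set c : A := b + algebraMap ℂ A (t * Complex.I) with hc
    have hfc : (f c).im = (f b).im + t := by
      rw [hc, map_add, hf.apply_algebraMap]
      simp
    have hcc : star c * c = b * b + algebraMap ℂ A ((t : ℂ) ^ 2) := by
      have hs : star c = b - algebraMap ℂ A (t * Complex.I) := by
        rw [hc, star_add, hb.star_eq, ← algebraMap_star_comm]
        simp [sub_eq_add_neg]
      have hI : algebraMap ℂ A ((t : ℂ) ^ 2)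
          = -(algebraMap ℂ A (t * Complex.I) * algebraMap ℂ A (t * Complex.I)) := by
        rw [← map_mul, ← map_neg]
        congr 1
        linear_combination (t : ℂ) ^ 2 * Complex.I_sq
      rw [hs, hI, hc, sub_mul, mul_add, mul_add, Algebra.commutes (t * Complex.I : ℂ) b]
      abel
    have hnorm : ‖c‖ ^ 2 ≤ ‖b‖ ^ 2 + t ^ 2 := by
      rw [sq, ← CStarRing.norm_star_mul_self, hcc]
      refine (norm_add_le _ _).trans (add_le_add ?_ ?_)
      · rw [sq]
        exact norm_mul_le b b
      · rw [norm_algebraMap']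
        simp
    calc ((f b).im + t) ^ 2 = |(f c).im| ^ 2 := by rw [sq_abs, hfc]
      _ ≤ ‖c‖ ^ 2 := by
        gcongr
        exact (Complex.abs_im_le_norm _).trans (hf.norm_apply_le c)
      _ ≤ _ := hnorm
  by_contra hne
  have h := key ((‖b‖ ^ 2 + 1) / (2 * (f b).im))
  have h2 : 2 * (f b).im * ((‖b‖ ^ 2 + 1) / (2 * (f b).im)) = ‖b‖ ^ 2 + 1 := by
    field_simp
  nlinarith [sq_nonneg (f b).im]

lemma norm_apply_star (hf : IsState f) (a : A) : ‖f (star a)‖ = ‖f a‖ := by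
  have hr := hf.im_apply_eq_zero (realPart a).2
  have hi := hf.im_apply_eq_zero (imaginaryPart a).2
  have h : f (star a) = star (f a) := by
    rw [← realPart_add_I_smul_imaginaryPart a, star_add, star_smul,
      (realPart a).2.star_eq, (imaginaryPart a).2.star_eq, map_add, map_add, map_smul, map_smul]
    apply Complex.ext <;> simp [hr, hi]
  rw [h, norm_star]

variable [PartialOrder A] [StarOrderedRing A]

lemma re_apply_nonneg (hf : IsState f) {b : A} (hb : 0 ≤ b) : 0 ≤ (f b).re := by
  have := hf.nontrivial
  have h1 : b ≤ algebraMap ℝ A ‖b‖ := (IsSelfAdjoint.of_nonneg hb).le_algebraMap_norm_self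
  have h2 : ‖algebraMap ℝ A ‖b‖ - b‖ ≤ ‖algebraMap ℝ A ‖b‖‖ :=
    CStarAlgebra.norm_le_norm_of_nonneg_of_le (sub_nonneg.2 h1) (sub_le_self _ hb)
  rw [norm_algebraMap', norm_norm] at h2
  have h3 : (f (algebraMap ℝ A ‖b‖ - b)).re = ‖b‖ - (f b).re := by
    rw [map_sub, IsScalarTower.algebraMap_apply ℝ ℂ A, hf.apply_algebraMap]
    simp
  linarith [(Complex.re_le_norm _).trans (hf.norm_apply_le (algebraMap ℝ A ‖b‖ - b))]

lemma re_apply_mono (hf : IsState f) {b c : A} (h : b ≤ c) : (f b).re ≤ (f c).re := by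
  have := hf.re_apply_nonneg (sub_nonneg.2 h)
  rwa [map_sub, Complex.sub_re, sub_nonneg] at this

end IsState

/-- If `σ` is monotone in each argument on nonnegative reals and `a` is hyponormal
(`aa* ≤ a*a`), then `‖a*‖_σ ≤ ‖a‖_σ`. -/
theorem sigmaNorm_star_le_sigmaNorm {A : Type*} [CStarAlgebra A] [PartialOrder A]
    [StarOrderedRing A] (σ : ℝ → ℝ → ℝ)
    (hσ : ∀ x x' y y' : ℝ, 0 ≤ x → x ≤ x' → 0 ≤ y → y ≤ y' → σ x y ≤ σ x' y') (a : A)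
    (ha : a * star a ≤ star a * a) :
    sigmaNorm σ (star a) ≤ sigmaNorm σ a := by
  refine Real.sSup_le ?_ (Real.sSup_nonneg ?_)
  · rintro _ ⟨f, hf, rfl⟩
    refine le_csSup_of_le ⟨Real.sqrt (σ (‖a‖ ^ 2) ‖star a * a‖), ?_⟩ ⟨f, hf, rfl⟩ ?_
    · rintro _ ⟨g, hg, rfl⟩
      refine Real.sqrt_le_sqrt (hσ _ _ _ _ (sq_nonneg _) ?_
        (hg.re_apply_nonneg (star_mul_self_nonneg a)) ?_)
      · gcongr
        exact hg.norm_apply_le a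
      · exact (Complex.re_le_norm _).trans (hg.norm_apply_le _)
    · rw [hf.norm_apply_star, star_star]
      exact Real.sqrt_le_sqrt (hσ _ _ _ _ (sq_nonneg _) le_rfl
        (hf.re_apply_nonneg (mul_star_self_nonneg a)) (hf.re_apply_mono ha))
  · rintro _ ⟨f, -, rfl⟩
    exact Real.sqrt_nonneg _
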